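/- Let Γ={g₁,…,g_k} be a finite admissible set of orientation-preserving circle homeomorphisms, p=(p₁,…,p_k) a probability vector with all pᵢ>0, P the associated Markov operator and μ* its unique invariant Borel probability measure. Let Ω={1,…,k}^ℕ with ℙ the product of countably many copies of the distribution p. Then the Strong Law of Large Numbers holds for trajectories starting from an arbitrary point: for every continuous φ:S¹→ℝ and every x∈S¹ there exists Ω'⊆Ω with ℙ(Ω')=1 such that for every ω=(i₁,i₂,…)∈Ω', (1/n)·∑_{j=1}^{n} φ(g_{i_j}∘g_{i_{j-1}}∘⋯∘g_{i_1}(x)) → ∫_{S¹} φ dμ* as n→∞. -/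

import Mathlib

open MeasureTheory Filter Topology

noncomputable section

/-- The circle `ℝ/ℤ` with normalized arc length (Haar probability measure as `volume`). -/
abbrev S1 : Type := UnitAddCircle

/-- `h` is an orientation-preserving circle homeomorphism: it admits a strictly increasing
continuous lift `G : ℝ → ℝ` with `G (t+1) = G t + 1`. -/
def IsOPH (h : S1 ≃ₜ S1) : Prop :=
  ∃ G : ℝ → ℝ, StrictMono G ∧ Continuous G ∧ (∀ t, G (t + 1) = G t + 1) ∧
    ∀ t : ℝ, h ((t : ℝ) : S1) = ((G t : ℝ) : S1)

/-- For a word `w = [i₁, …, i_n]`, `applyWord g w = g_{i_n} ∘ ⋯ ∘ g_{i_1}`. -/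
def applyWord {k : ℕ} (g : Fin k → S1 ≃ₜ S1) (w : List (Fin k)) (x : S1) : S1 :=
  w.foldl (fun y i => g i y) x

/-- `Γ` is admissible: some generator has a dense forward orbit `{gᵢⁿ x : n ≥ 1}`. -/
def Admissible {k : ℕ} (g : Fin k → S1 ≃ₜ S1) : Prop :=
  ∃ i : Fin k, ∃ x : S1, Dense (Set.range fun n : ℕ => (⇑(g i))^[n + 1] x)

/-- The action of `Γ` is contractive: every `x` has an open arc neighbourhood whose image
under suitable words has Haar measure tending to `0`. -/
def Contractive {k : ℕ} (g : Fin k → S1 ≃ₜ S1) : Prop :=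
  ∀ x : S1, ∃ a b : ℝ, a < b ∧ b - a < 1 ∧
    x ∈ (fun t : ℝ => (t : S1)) '' Set.Ioo a b ∧
    ∃ w : ℕ → List (Fin k),
      Tendsto (fun m => volume (applyWord g (w m) '' ((fun t : ℝ => (t : S1)) '' Set.Ioo a b)))
        atTop (𝓝 0)

/-- The Markov operator `P μ = ∑ᵢ pᵢ • (gᵢ)_* μ` of the IFS `(Γ, p)`. -/
def markovP {k : ℕ} (p : Fin k → ℝ) (g : Fin k → S1 ≃ₜ S1) (μ : Measure S1) : Measure S1 :=
  ∑ i : Fin k, ENNReal.ofReal (p i) • Measure.map (g i) μ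

/-- The dual operator `P* f x = ∑ᵢ pᵢ f (gᵢ x)`. -/
def dualP {k : ℕ} (p : Fin k → ℝ) (g : Fin k → S1 ≃ₜ S1) (f : S1 → ℝ) (x : S1) : ℝ :=
  ∑ i : Fin k, p i * f (g i x)

/-- Asymptotic stability of the IFS `(Γ, p)`: there is a unique invariant Borel probability
measure `μ*`, and `Pⁿ μ → μ*` weakly for every Borel probability measure `μ`. -/
def AsympStable {k : ℕ} (p : Fin k → ℝ) (g : Fin k → S1 ≃ₜ S1) : Prop :=
  ∃ μs : Measure S1, IsProbabilityMeasure μs ∧ markovP p g μs = μs ∧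
    (∀ ν : Measure S1, IsProbabilityMeasure ν → markovP p g ν = ν → ν = μs) ∧
    ∀ μ : Measure S1, IsProbabilityMeasure μ → ∀ f : C(S1, ℝ),
      Tendsto (fun n => ∫ x, f x ∂((markovP p g)^[n] μ)) atTop (𝓝 (∫ x, f x ∂μs))

/-- For `ω = (i₁, i₂, …)`, `fwdComp g ω n = g_{i_n} ∘ ⋯ ∘ g_{i_1}` (here `i_j = ω (j-1)`). -/
def fwdComp {k : ℕ} (g : Fin k → S1 ≃ₜ S1) (ω : ℕ → Fin k) : ℕ → S1 → S1
  | 0 => id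
  | n + 1 => (fun x => g (ω n) x) ∘ fwdComp g ω n

section UniqueErgodicity

variable {k : ℕ} {p : Fin k → ℝ} {g : Fin k → S1 ≃ₜ S1}

/-- The dual operator as a linear endomorphism of the space of continuous functions. -/
def dualLinearMap (p : Fin k → ℝ) (g : Fin k → S1 ≃ₜ S1) : C(S1, ℝ) →ₗ[ℝ] C(S1, ℝ) where
  toFun f := ∑ i, p i • f.comp (g i : C(S1, S1))
  map_add' f h := by
    ext x
    simp [Finset.sum_add_distrib]
  map_smul' c f := by
    ext x
    simp [Finset.mul_sum, mul_left_comm]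

lemma dualLinearMap_apply (f : C(S1, ℝ)) (x : S1) :
    dualLinearMap p g f x = ∑ i, p i * f (g i x) := by
  simp [dualLinearMap]

lemma abs_dualLinearMap_apply_le (hp : ∀ i, 0 < p i) (hsum : ∑ i, p i = 1) {f : C(S1, ℝ)}
    {C : ℝ} (hf : ∀ x, |f x| ≤ C) (x : S1) : |dualLinearMap p g f x| ≤ C := by
  rw [dualLinearMap_apply]
  calc |∑ i, p i * f (g i x)| ≤ ∑ i, |p i * f (g i x)| := Finset.abs_sum_le_sum_abs _ _
    _ ≤ ∑ i, p i * C := by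
      gcongr with i
      rw [abs_mul, abs_of_pos (hp i)]
      exact mul_le_mul_of_nonneg_left (hf _) (hp i).le
    _ = C := by rw [← Finset.sum_mul, hsum, one_mul]

lemma abs_dualLinearMap_pow_apply_le (hp : ∀ i, 0 < p i) (hsum : ∑ i, p i = 1) {f : C(S1, ℝ)}
    {C : ℝ} (hf : ∀ x, |f x| ≤ C) (n : ℕ) (x : S1) : |(dualLinearMap p g ^ n) f x| ≤ C := by
  induction n generalizing x with
  | zero => simpa using hf x
  | succ n ih =>
    rw [pow_succ', Module.End.mul_apply]
    exact abs_dualLinearMap_apply_le hp hsum ih x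

lemma isProbabilityMeasure_markovP (hp : ∀ i, 0 < p i) (hsum : ∑ i, p i = 1) (μ : Measure S1)
    [IsProbabilityMeasure μ] : IsProbabilityMeasure (markovP p g μ) := by
  constructor
  have h (i : Fin k) : Measure.map (g i) μ Set.univ = 1 := by
    rw [Measure.map_apply (g i).continuous.measurable .univ, Set.preimage_univ, measure_univ]
  simp [markovP, Measure.finsetSum_apply, h, ← ENNReal.ofReal_sum_of_nonneg fun i _ => (hp i).le,
    hsum]

lemma integrable_continuousMap (f : C(S1, ℝ)) (μ : Measure S1) [IsFiniteMeasure μ] :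
    Integrable f μ :=
  f.continuous.integrable_of_hasCompactSupport (HasCompactSupport.of_compactSpace f)

lemma integral_markovP (hp : ∀ i, 0 < p i) (μ : Measure S1) [IsFiniteMeasure μ] (f : C(S1, ℝ)) :
    ∫ y, f y ∂(markovP p g μ) = ∫ y, dualLinearMap p g f y ∂μ := by
  have hm (i : Fin k) : Measurable (g i) := (g i).continuous.measurable
  rw [markovP, integral_finsetSum_measure]
  · simp_rw [dualLinearMap_apply]
    rw [integral_finsetSum]
    · refine Finset.sum_congr rfl fun i _ => ?_
      rw [integral_smul_measure, integral_map (hm i).aemeasurable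
        f.continuous.aestronglyMeasurable, integral_const_mul, ENNReal.toReal_ofReal (hp i).le,
        smul_eq_mul]
    · intro i _
      exact (integrable_continuousMap (f.comp (g i : C(S1, S1))) μ).const_mul (p i)
  · intro i _
    exact (integrable_continuousMap f _).smul_measure ENNReal.ofReal_ne_top

lemma isProbabilityMeasure_iterate_markovP (hp : ∀ i, 0 < p i) (hsum : ∑ i, p i = 1)
    (μ : Measure S1) [IsProbabilityMeasure μ] (n : ℕ) :
    IsProbabilityMeasure ((markovP p g)^[n] μ) := by
  induction n with
  | zero => simpa
  | succ n ih =>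
    rw [Function.iterate_succ_apply']
    exact isProbabilityMeasure_markovP hp hsum _

lemma integral_iterate_markovP (hp : ∀ i, 0 < p i) (hsum : ∑ i, p i = 1) (μ : Measure S1)
    [IsProbabilityMeasure μ] (n : ℕ) (f : C(S1, ℝ)) :
    ∫ y, f y ∂((markovP p g)^[n] μ) = ∫ y, (dualLinearMap p g ^ n) f y ∂μ := by
  induction n generalizing f with
  | zero => simp
  | succ n ih =>
    have := isProbabilityMeasure_iterate_markovP (g := g) hp hsum μ n
    rw [Function.iterate_succ_apply', integral_markovP hp, ih, pow_succ, Module.End.mul_apply]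

/-- Cesàro averages of the orbit of a point are integrals against a probability measure. -/
lemma exists_probabilityMeasure_integral_eq_average (hp : ∀ i, 0 < p i) (hsum : ∑ i, p i = 1)
    (n : ℕ) (x : S1) : ∃ ν : ProbabilityMeasure S1, ∀ f : C(S1, ℝ),
      ∫ y, f y ∂(ν : Measure S1) =
        ((n : ℝ) + 1)⁻¹ * ∑ j ∈ Finset.range (n + 1), (dualLinearMap p g ^ j) f x := by
  have hP := isProbabilityMeasure_iterate_markovP (g := g) hp hsum (Measure.dirac x)
  have hc : (((n : ENNReal) + 1)⁻¹).toReal = ((n : ℝ) + 1)⁻¹ := by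
    rw [ENNReal.toReal_inv, ENNReal.toReal_add (by simp) (by simp)]
    simp
  refine ⟨⟨((n : ENNReal) + 1)⁻¹ • ∑ j ∈ Finset.range (n + 1),
    (markovP p g)^[j] (Measure.dirac x), ⟨?_⟩⟩, fun f => ?_⟩
  · simp only [Measure.smul_apply, Measure.finsetSum_apply, measure_univ, Finset.sum_const,
      Finset.card_range, nsmul_eq_mul, mul_one, smul_eq_mul, Nat.cast_add, Nat.cast_one]
    exact ENNReal.inv_mul_cancel (by simp) (by simp)
  · rw [ProbabilityMeasure.coe_mk, integral_smul_measure, hc, integral_finsetSum_measure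
      fun j _ => integrable_continuousMap f _, smul_eq_mul]
    simp_rw [integral_iterate_markovP hp hsum, integral_dirac]

/-- Unique ergodicity implies that the Cesàro averages get uniformly close to the mean. -/
lemma exists_forall_abs_average_sub_integral_le (hp : ∀ i, 0 < p i) (hsum : ∑ i, p i = 1)
    (μs : Measure S1)
    (huniq : ∀ ν : Measure S1, IsProbabilityMeasure ν → markovP p g ν = ν → ν = μs)
    (φ : C(S1, ℝ)) {ε : ℝ} (hε : 0 < ε) :
    ∃ n : ℕ, ∀ x, |((n : ℝ) + 1)⁻¹ * ∑ j ∈ Finset.range (n + 1), (dualLinearMap p g ^ j) φ x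
      - ∫ y, φ y ∂μs| ≤ ε := by
  by_contra! hcon
  choose x hx using hcon
  choose ν hν using fun n =>
    exists_probabilityMeasure_integral_eq_average (g := g) hp hsum n (x n)
  let U : Ultrafilter ℕ := Filter.hyperfilter ℕ
  have hU : (U : Filter ℕ) ≤ atTop := by
    rw [← Nat.cofinite_eq_atTop]
    exact Filter.hyperfilter_le_cofinite
  obtain ⟨ν', -, hlim⟩ := isCompact_univ.ultrafilter_le_nhds (U.map ν) (by simp)
  have hlim : Tendsto ν U (𝓝 ν') := hlim
  have hint (f : C(S1, ℝ)) : Tendsto (fun n : ℕ => ((n : ℝ) + 1)⁻¹ *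
      ∑ j ∈ Finset.range (n + 1), (dualLinearMap p g ^ j) f (x n)) U
        (𝓝 (∫ y, f y ∂(ν' : Measure S1))) := by
    simpa only [BoundedContinuousFunction.mkOfCompact_apply, hν] using
      ProbabilityMeasure.tendsto_iff_forall_integral_tendsto.1 hlim
        (BoundedContinuousFunction.mkOfCompact f)
  have hinvf (f : C(S1, ℝ)) : ∫ y, dualLinearMap p g f y ∂(ν' : Measure S1) =
      ∫ y, f y ∂(ν' : Measure S1) := by
    have h0 : Tendsto (fun n : ℕ => ((n : ℝ) + 1)⁻¹ * (2 * ‖f‖)) U (𝓝 0) := by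
      have h1 : Tendsto (fun n : ℕ => ((n : ℝ) + 1)⁻¹) atTop (𝓝 0) := by
        simpa using tendsto_one_div_add_atTop_nhds_zero_nat (𝕜 := ℝ)
      simpa using (h1.mul_const (2 * ‖f‖)).mono_left hU
    have hd := (hint (dualLinearMap p g f)).sub (hint f)
    refine sub_eq_zero.1 (tendsto_nhds_unique hd (squeeze_zero_norm (fun n => ?_) h0))
    have hT (j : ℕ) : (dualLinearMap p g ^ j) (dualLinearMap p g f) =
        (dualLinearMap p g ^ (j + 1)) f := by
      rw [pow_succ, Module.End.mul_apply]
    rw [← mul_sub, ← Finset.sum_sub_distrib, norm_mul, Real.norm_of_nonneg (by positivity)]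
    gcongr
    simp_rw [hT]
    rw [Finset.sum_range_sub fun j => (dualLinearMap p g ^ j) f (x n)]
    have hf : ∀ y, |f y| ≤ ‖f‖ := f.norm_coe_le_norm
    calc ‖_‖ ≤ _ + _ := norm_sub_le _ _
      _ ≤ ‖f‖ + ‖f‖ := add_le_add (abs_dualLinearMap_pow_apply_le hp hsum hf _ _)
        (abs_dualLinearMap_pow_apply_le hp hsum hf _ _)
      _ = 2 * ‖f‖ := by ring
  have := isProbabilityMeasure_markovP (g := g) hp hsum (ν' : Measure S1)
  have hinv : markovP p g (ν' : Measure S1) = ν' := by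
    refine ext_of_forall_integral_eq_of_IsFiniteMeasure fun f => ?_
    exact (integral_markovP hp _ f.toContinuousMap).trans (hinvf f.toContinuousMap)
  have hc := ((hint φ).sub_const (∫ y, φ y ∂μs)).abs
  rw [huniq _ inferInstance hinv, sub_self, abs_zero] at hc
  exact hε.not_ge (ge_of_tendsto' hc fun n => (hx n).le)

/-- Under unique ergodicity, every continuous function is, up to a constant and an arbitrarily
small error, a coboundary. -/
lemma exists_forall_abs_sub_coboundary_le (hp : ∀ i, 0 < p i) (hsum : ∑ i, p i = 1)
    (μs : Measure S1)
    (huniq : ∀ ν : Measure S1, IsProbabilityMeasure ν → markovP p g ν = ν → ν = μs)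
    (φ : C(S1, ℝ)) {ε : ℝ} (hε : 0 < ε) :
    ∃ ψ : C(S1, ℝ), ∀ x, |φ x - ∫ y, φ y ∂μs - (ψ x - dualLinearMap p g ψ x)| ≤ ε := by
  obtain ⟨n, hn⟩ := exists_forall_abs_average_sub_integral_le hp hsum μs huniq φ hε
  refine ⟨((n : ℝ) + 1)⁻¹ • ∑ j ∈ Finset.range (n + 1), ∑ i ∈ Finset.range j,
    (dualLinearMap p g ^ i) φ, fun x => ?_⟩
  convert hn x using 2
  have hT (i : ℕ) : dualLinearMap p g ((dualLinearMap p g ^ i) φ) =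
      (dualLinearMap p g ^ (i + 1)) φ := by
    rw [pow_succ', Module.End.mul_apply]
  have hne : ((n : ℝ) + 1) ≠ 0 := by positivity
  simp only [map_smul, map_sum, hT, ContinuousMap.coe_smul, ContinuousMap.coe_sum, Pi.smul_apply,
    Finset.sum_apply, smul_eq_mul]
  rw [← mul_sub, ← Finset.sum_sub_distrib]
  simp_rw [← Finset.sum_sub_distrib]
  simp_rw [Finset.sum_range_sub' fun i => (dualLinearMap p g ^ i) φ x]
  rw [Finset.sum_sub_distrib]
  simp
  field_simp
  ring

end UniqueErgodicity

section StrongLaw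

/-- Strong law of large numbers for uniformly bounded increments, each orthogonal to the sum of the
preceding ones. -/
lemma ae_tendsto_inv_mul_sum_of_bounded_of_orthogonal {Ω : Type*} [MeasurableSpace Ω]
    {ℙ : Measure Ω} [IsProbabilityMeasure ℙ] {D : ℕ → Ω → ℝ} {C : ℝ}
    (hm : ∀ n, Measurable (D n)) (hC : ∀ n ω, |D n ω| ≤ C)
    (horth : ∀ n, ∫ ω, (∑ j ∈ Finset.range n, D j ω) * D n ω ∂ℙ = 0) :
    ∀ᵐ ω ∂ℙ, Tendsto (fun n : ℕ => (n : ℝ)⁻¹ * ∑ j ∈ Finset.range n, D j ω) atTop (𝓝 0) := by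
  set S : ℕ → Ω → ℝ := fun n ω => ∑ j ∈ Finset.range n, D j ω with hS
  have hSm (n : ℕ) : Measurable (S n) := Finset.measurable_fun_sum _ fun j _ => hm j
  have hSb (n : ℕ) (ω : Ω) : |S n ω| ≤ n * C :=
    calc |S n ω| ≤ ∑ j ∈ Finset.range n, |D j ω| := Finset.abs_sum_le_sum_abs _ _
      _ ≤ ∑ _j ∈ Finset.range n, C := Finset.sum_le_sum fun j _ => hC j ω
      _ = n * C := by simp
  have hbdd {f : Ω → ℝ} {B : ℝ} (hf : Measurable f) (hB : ∀ ω, |f ω| ≤ B) : Integrable f ℙ :=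
    .of_bound hf.aestronglyMeasurable B (ae_of_all _ hB)
  have hprod {f h : Ω → ℝ} {A B : ℝ} (hf : Measurable f) (hh : Measurable h)
      (hA : ∀ ω, |f ω| ≤ A) (hB : ∀ ω, |h ω| ≤ B) : Integrable (fun ω => f ω * h ω) ℙ :=
    hbdd (hf.mul hh) (B := A * B) fun ω => by
      rw [abs_mul]
      exact mul_le_mul (hA ω) (hB ω) (abs_nonneg _) ((abs_nonneg _).trans (hA ω))
  have hvar (n : ℕ) : ∫ ω, S n ω * S n ω ∂ℙ ≤ n * C ^ 2 := by
    induction n with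
    | zero => simp [hS]
    | succ n ih =>
      have hsucc (ω : Ω) : S (n + 1) ω * S (n + 1) ω =
          S n ω * S n ω + 2 * (S n ω * D n ω) + D n ω * D n ω := by
        simp only [hS, Finset.sum_range_succ]
        ring
      have hSS := hprod (hSm n) (hSm n) (hSb n) (hSb n)
      have hSD := (hprod (hSm n) (hm n) (hSb n) (hC n)).const_mul 2
      have hDD := hprod (hm n) (hm n) (hC n) (hC n)
      have hle : ∫ ω, D n ω * D n ω ∂ℙ ≤ C ^ 2 := by
        calc ∫ ω, D n ω * D n ω ∂ℙ ≤ ∫ _ω, C ^ 2 ∂ℙ := by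
              refine integral_mono hDD (integrable_const _) fun ω => ?_
              have := hC n ω
              simp only [← sq, ← sq_abs (D n ω)]
              gcongr
          _ = C ^ 2 := by simp
      simp_rw [hsucc]
      rw [integral_add (f := fun ω => S n ω * S n ω + 2 * (S n ω * D n ω)) (hSS.add hSD) hDD,
        integral_add hSS hSD, integral_const_mul, horth n]
      push_cast
      linarith
  have hsummable : Summable fun n : ℕ => C ^ 2 * ((n : ℝ) ^ 2)⁻¹ :=
    (Real.summable_nat_pow_inv.2 one_lt_two).mul_left _
  have hterm (n : ℕ) : ∫⁻ ω, ENNReal.ofReal ((S (n ^ 2) ω / (n ^ 2 : ℕ)) ^ 2) ∂ℙ ≤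
      ENNReal.ofReal (C ^ 2 * ((n : ℝ) ^ 2)⁻¹) := by
    have heq : (fun ω => (S (n ^ 2) ω / (n ^ 2 : ℕ)) ^ 2) =
        fun ω => (((n : ℝ) ^ 2) ^ 2)⁻¹ * (S (n ^ 2) ω * S (n ^ 2) ω) := by
      ext ω
      push_cast
      rw [div_pow, div_eq_inv_mul, sq (S _ _)]
    have hi := (hprod (hSm (n ^ 2)) (hSm (n ^ 2)) (hSb _) (hSb _)).const_mul (((n : ℝ) ^ 2) ^ 2)⁻¹
    rw [← ofReal_integral_eq_lintegral_ofReal (by rw [heq]; exact hi)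
      (ae_of_all _ fun ω => sq_nonneg _), heq, integral_const_mul]
    refine ENNReal.ofReal_le_ofReal ?_
    rcases eq_or_ne n 0 with rfl | hn
    · simp
    · calc _ ≤ (((n : ℝ) ^ 2) ^ 2)⁻¹ * ((n ^ 2 : ℕ) * C ^ 2) := by
            gcongr
            exact hvar _
        _ = _ := by
            push_cast
            field_simp
  have hmeas (n : ℕ) : Measurable fun ω => ENNReal.ofReal ((S (n ^ 2) ω / (n ^ 2 : ℕ)) ^ 2) :=
    (((hSm _).div_const _).pow_const 2).ennreal_ofReal
  have hfin : ∫⁻ ω, ∑' n : ℕ, ENNReal.ofReal ((S (n ^ 2) ω / (n ^ 2 : ℕ)) ^ 2) ∂ℙ ≠ ⊤ := by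
    rw [lintegral_tsum fun n => (hmeas n).aemeasurable]
    refine ne_top_of_le_ne_top ?_ (ENNReal.tsum_le_tsum hterm)
    exact hsummable.tsum_ofReal_ne_top
  filter_upwards [ae_lt_top (Measurable.tsum hmeas) hfin] with ω hω
  have hsq : Tendsto (fun n : ℕ => S (n ^ 2) ω / (n ^ 2 : ℕ)) atTop (𝓝 0) := by
    have h := (ENNReal.tendsto_toReal ENNReal.zero_ne_top).comp
      (ENNReal.tendsto_atTop_zero_of_tsum_ne_top hω.ne)
    have h2 : Tendsto (fun n : ℕ => (S (n ^ 2) ω / (n ^ 2 : ℕ)) ^ 2) atTop (𝓝 0) := by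
      simpa [Function.comp_def, ENNReal.toReal_ofReal, sq_nonneg] using h
    rw [tendsto_zero_iff_abs_tendsto_zero]
    simpa only [Function.comp_def, Real.sqrt_sq_eq_abs, Real.sqrt_zero] using h2.sqrt
  have hmono : Monotone fun n : ℕ => S n ω + n * C := by
    refine monotone_nat_of_le_succ fun n => ?_
    have := neg_le_of_abs_le (hC n ω)
    simp only [hS, Finset.sum_range_succ]
    push_cast
    linarith
  have hlim := tendsto_div_of_monotone_of_exists_subseq_tendsto_div _ C hmono fun a ha => by
    refine ⟨fun n => n ^ 2, ?_, tendsto_pow_atTop two_ne_zero, ?_⟩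
    · filter_upwards [eventually_ge_atTop 1, eventually_ge_atTop ⌈3 / (a - 1)⌉₊] with n h1 h2
      have h1' : (1 : ℝ) ≤ n := by exact_mod_cast h1
      have h3 : 3 ≤ n * (a - 1) := (div_le_iff₀ (sub_pos.2 ha)).1 (Nat.ceil_le.1 h2)
      push_cast
      nlinarith
    · refine (zero_add C ▸ hsq.add_const C).congr' ?_
      filter_upwards [eventually_ne_atTop 0] with n hn
      have : (n : ℝ) ≠ 0 := by exact_mod_cast hn
      push_cast
      field_simp
  refine (sub_self C ▸ hlim.sub_const C).congr' ?_
  filter_upwards [eventually_ne_atTop 0] with n hn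
  have : (n : ℝ) ≠ 0 := by exact_mod_cast hn
  field_simp
  ring

end StrongLaw

section Bernoulli

variable {k : ℕ} {p : Fin k → ℝ} {ℙ : Measure (ℕ → Fin k)}

lemma measurable_of_dependsOn_Iio {f : (ℕ → Fin k) → ℝ} {n : ℕ} (hf : DependsOn f (Set.Iio n)) :
    Measurable f := by
  obtain ⟨F, rfl⟩ := dependsOn_iff_exists_comp.1 hf
  exact (Measurable.of_discrete (f := F)).comp
    (measurable_pi_lambda _ fun j => measurable_pi_apply _)

lemma integrable_of_dependsOn_Iio [IsFiniteMeasure ℙ] {f : (ℕ → Fin k) → ℝ} {n : ℕ}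
    (hf : DependsOn f (Set.Iio n)) : Integrable f ℙ := by
  obtain ⟨F, rfl⟩ := dependsOn_iff_exists_comp.1 hf
  have hr : Measurable ((Set.Iio n).domRestrict : (ℕ → Fin k) → _) :=
    measurable_pi_lambda _ fun j => measurable_pi_apply _
  exact (Integrable.of_finite (f := F)).comp_measurable hr

lemma map_domRestrict_restrict_eq_smul
    (hprod : ∀ (n : ℕ) (c : ℕ → Fin k),
      ℙ {ω | ∀ j < n, ω j = c j} = ∏ j ∈ Finset.range n, ENNReal.ofReal (p (c j)))
    (n : ℕ) (i : Fin k) :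
    (ℙ.restrict {ω | ω n = i}).map (Set.Iio n).domRestrict =
      ENNReal.ofReal (p i) • ℙ.map (Set.Iio n).domRestrict := by
  have hr : Measurable ((Set.Iio n).domRestrict : (ℕ → Fin k) → _) :=
    measurable_pi_lambda _ fun j => measurable_pi_apply _
  refine Measure.ext_of_singleton fun c => ?_
  let c' : ℕ → Fin k := fun j => if h : j < n then c ⟨j, h⟩ else i
  have hc' : ((Set.Iio n).domRestrict : (ℕ → Fin k) → _) ⁻¹' {c} =
      {ω | ∀ j < n, ω j = c' j} := by
    ext ω
    simp +contextual [funext_iff, c']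
  have hc'' : {ω : ℕ → Fin k | ∀ j < n, ω j = c' j} ∩ {ω | ω n = i} =
      {ω | ∀ j < n + 1, ω j = c' j} := by
    ext ω
    have hn : c' n = i := by simp [c']
    exact Nat.forall_lt_succ_right.trans (by rw [hn]; rfl) |>.symm
  rw [Measure.smul_apply, Measure.map_apply hr (.singleton c), Measure.map_apply hr (.singleton c),
    Measure.restrict_apply (hr (.singleton c)), hc', hc'', hprod, hprod, Finset.prod_range_succ,
    smul_eq_mul, mul_comm]
  simp [c']

lemma setIntegral_eq_mul_integral_of_dependsOn (hp : ∀ i, 0 < p i)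
    (hprod : ∀ (n : ℕ) (c : ℕ → Fin k),
      ℙ {ω | ∀ j < n, ω j = c j} = ∏ j ∈ Finset.range n, ENNReal.ofReal (p (c j)))
    {n : ℕ} {f : (ℕ → Fin k) → ℝ} (hf : DependsOn f (Set.Iio n)) (i : Fin k) :
    ∫ ω in {ω | ω n = i}, f ω ∂ℙ = p i * ∫ ω, f ω ∂ℙ := by
  obtain ⟨F, rfl⟩ := dependsOn_iff_exists_comp.1 hf
  have hr : Measurable ((Set.Iio n).domRestrict : (ℕ → Fin k) → _) :=
    measurable_pi_lambda _ fun j => measurable_pi_apply _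
  have hF : StronglyMeasurable F := .of_discrete
  simp only [Function.comp_apply]
  rw [← integral_map hr.aemeasurable hF.aestronglyMeasurable,
    ← integral_map hr.aemeasurable hF.aestronglyMeasurable,
    map_domRestrict_restrict_eq_smul hprod, integral_smul_measure,
    ENNReal.toReal_ofReal (hp i).le, smul_eq_mul]

/-- A function of the first `n + 1` letters whose average over the last letter vanishes has
vanishing expectation. -/
lemma integral_eq_zero_of_sum_mul_eq_zero [IsProbabilityMeasure ℙ] (hp : ∀ i, 0 < p i)
    (hprod : ∀ (n : ℕ) (c : ℕ → Fin k),
      ℙ {ω | ∀ j < n, ω j = c j} = ∏ j ∈ Finset.range n, ENNReal.ofReal (p (c j)))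
    {n : ℕ} {H : (ℕ → Fin k) → Fin k → ℝ} (hH : DependsOn H (Set.Iio n))
    (hzero : ∀ ω, ∑ i, p i * H ω i = 0) : ∫ ω, H ω (ω n) ∂ℙ = 0 := by
  have hHi (i : Fin k) : DependsOn (fun ω => H ω i) (Set.Iio n) := fun ω ω' h => by
    simp only [hH h]
  have hA (i : Fin k) : MeasurableSet {ω : ℕ → Fin k | ω n = i} :=
    measurableSet_eq_fun (measurable_pi_apply n) measurable_const
  have hsplit (ω : ℕ → Fin k) :
      H ω (ω n) = ∑ i, ({ω | ω n = i} : Set (ℕ → Fin k)).indicator (fun ω => H ω i) ω := by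
    simp [Set.indicator_apply]
  simp_rw [hsplit]
  rw [integral_finsetSum _ fun i _ => (integrable_of_dependsOn_Iio (hHi i)).indicator (hA i)]
  simp_rw [integral_indicator (hA _), setIntegral_eq_mul_integral_of_dependsOn hp hprod (hHi _),
    ← integral_const_mul]
  rw [← integral_finsetSum _ fun i _ => (integrable_of_dependsOn_Iio (hHi i)).const_mul (p i)]
  simp [hzero]

end Bernoulli

section Trajectory

variable {k : ℕ} {p : Fin k → ℝ} {g : Fin k → S1 ≃ₜ S1}

lemma dependsOn_fwdComp (n : ℕ) (x : S1) : DependsOn (fun ω => fwdComp g ω n x) (Set.Iio n) := by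
  induction n with
  | zero => intro ω ω' _; rfl
  | succ n ih =>
    intro ω ω' h
    have h1 : fwdComp g ω n x = fwdComp g ω' n x := ih fun j hj => h j (Nat.lt_succ_of_lt hj)
    have h2 : ω n = ω' n := h n (Nat.lt_succ_self n)
    simp [fwdComp, h1, h2]

lemma ae_tendsto_martingale_part (hp : ∀ i, 0 < p i) (hsum : ∑ i, p i = 1)
    {ℙ : Measure (ℕ → Fin k)} [IsProbabilityMeasure ℙ]
    (hprod : ∀ (n : ℕ) (c : ℕ → Fin k),
      ℙ {ω | ∀ j < n, ω j = c j} = ∏ j ∈ Finset.range n, ENNReal.ofReal (p (c j)))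
    (ψ : C(S1, ℝ)) (x : S1) :
    ∀ᵐ ω ∂ℙ, Tendsto (fun n : ℕ => (n : ℝ)⁻¹ * ∑ j ∈ Finset.range n,
      (ψ (fwdComp g ω (j + 1) x) - dualLinearMap p g ψ (fwdComp g ω j x))) atTop (𝓝 0) := by
  have hψ : ∀ y, |ψ y| ≤ ‖ψ‖ := ψ.norm_coe_le_norm
  have hdep (n : ℕ) : DependsOn (fun ω => ψ (fwdComp g ω (n + 1) x) -
      dualLinearMap p g ψ (fwdComp g ω n x)) (Set.Iio (n + 1)) := fun ω ω' h => by
    have h1 : fwdComp g ω (n + 1) x = fwdComp g ω' (n + 1) x := dependsOn_fwdComp _ x h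
    have h2 : fwdComp g ω n x = fwdComp g ω' n x :=
      dependsOn_fwdComp _ x fun j hj => h j (Nat.lt_succ_of_lt hj)
    simp only [h1, h2]
  refine ae_tendsto_inv_mul_sum_of_bounded_of_orthogonal (C := ‖ψ‖ + ‖ψ‖)
    (fun n => measurable_of_dependsOn_Iio (hdep n)) (fun n ω => ?_) fun n => ?_
  · exact (abs_sub _ _).trans
      (add_le_add (hψ _) (abs_dualLinearMap_apply_le hp hsum hψ _))
  · refine integral_eq_zero_of_sum_mul_eq_zero hp hprod (n := n) (H := fun ω i =>
      (∑ j ∈ Finset.range n, (ψ (fwdComp g ω (j + 1) x) -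
        dualLinearMap p g ψ (fwdComp g ω j x))) *
      (ψ (g i (fwdComp g ω n x)) - dualLinearMap p g ψ (fwdComp g ω n x))) ?_ fun ω => ?_
    · intro ω ω' h
      have h1 : fwdComp g ω n x = fwdComp g ω' n x := dependsOn_fwdComp _ x h
      ext i
      simp only [h1]
      congr 1
      refine Finset.sum_congr rfl fun j hj => hdep j fun l hl => h l ?_
      exact lt_of_lt_of_le (Set.mem_Iio.1 hl) (Finset.mem_range.1 hj)
    · simp_rw [mul_left_comm (p _), ← Finset.mul_sum, mul_sub, Finset.sum_sub_distrib,
        ← Finset.sum_mul, hsum, one_mul, ← dualLinearMap_apply, sub_self, mul_zero]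

end Trajectory

/-- Strong Law of Large Numbers for trajectories of an admissible IFS
starting from an arbitrary point: for every continuous `φ` and every `x` there is a set
`Ω' ⊆ Ω` of full `ℙ`-measure such that for every `ω ∈ Ω'` the Birkhoff averages
`(1/n) ∑_{j=1}^{n} φ(g_{i_j} ∘ ⋯ ∘ g_{i_1}(x))` converge to `∫ φ dμ*`. -/
theorem admissible_ifs_strong_law_of_large_numbers {k : ℕ} (g : Fin k → S1 ≃ₜ S1)
    (hg : ∀ i, IsOPH (g i)) (hadm : Admissible g)
    (p : Fin k → ℝ) (hp : ∀ i, 0 < p i) (hsum : ∑ i, p i = 1)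
    (μs : Measure S1) (hμs : IsProbabilityMeasure μs) (hinv : markovP p g μs = μs)
    (huniq : ∀ ν : Measure S1, IsProbabilityMeasure ν → markovP p g ν = ν → ν = μs)
    (ℙ : Measure (ℕ → Fin k)) (hℙ : IsProbabilityMeasure ℙ)
    (hprod : ∀ (n : ℕ) (c : ℕ → Fin k),
      ℙ {ω | ∀ j < n, ω j = c j} = ∏ j ∈ Finset.range n, ENNReal.ofReal (p (c j)))
    (φ : C(S1, ℝ)) (x : S1) :
    ∃ Ω' : Set (ℕ → Fin k), ℙ Ω' = 1 ∧ ∀ ω ∈ Ω',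
      Tendsto (fun n : ℕ => (n : ℝ)⁻¹ * ∑ j ∈ Finset.range n, φ (fwdComp g ω (j + 1) x))
        atTop (𝓝 (∫ y, φ y ∂μs)) := by
  have key (m : ℕ) := exists_forall_abs_sub_coboundary_le hp hsum μs huniq φ
    (Nat.one_div_pos_of_nat (α := ℝ) (n := m))
  choose ψ hψ using key
  have hae := ae_all_iff.2 fun m => ae_tendsto_martingale_part (g := g) hp hsum hprod (ψ m) x
  refine ⟨{ω | Tendsto (fun n : ℕ => (n : ℝ)⁻¹ * ∑ j ∈ Finset.range n, φ (fwdComp g ω (j + 1) x))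
    atTop (𝓝 (∫ y, φ y ∂μs))}, ?_, fun ω hω => hω⟩
  rw [← measure_univ (μ := ℙ)]
  refine measure_congr (eventuallyEq_univ.2 ?_)
  filter_upwards [hae] with ω hω
  refine Metric.tendsto_atTop'.2 fun ε hε => ?_
  obtain ⟨m, hm⟩ := exists_nat_one_div_lt (half_pos hε)
  set c := ∫ y, φ y ∂μs with hc
  set T := dualLinearMap p g (ψ m) with hT
  set X : ℕ → S1 := fun j => fwdComp g ω j x with hX
  have hTb (y : S1) : |T y| ≤ ‖ψ m‖ :=
    abs_dualLinearMap_apply_le hp hsum (ψ m).norm_coe_le_norm y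
  have hB : Tendsto (fun n : ℕ => (n : ℝ)⁻¹ * (T (X 0) - T (X n))) atTop (𝓝 0) := by
    refine squeeze_zero_norm (a := fun n : ℕ => (n : ℝ)⁻¹ * (‖ψ m‖ + ‖ψ m‖)) (fun n => ?_) ?_
    · rw [norm_mul, Real.norm_of_nonneg (by positivity)]
      gcongr
      exact (abs_sub _ _).trans (add_le_add (hTb _) (hTb _))
    · simpa using tendsto_inv_atTop_nhds_zero_nat (𝕜 := ℝ) |>.mul_const (‖ψ m‖ + ‖ψ m‖)
  have hsmall := (Metric.tendsto_atTop'.1 ((hω m).add hB)) (ε / 2) (half_pos hε)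
  obtain ⟨N, hN⟩ := hsmall
  refine ⟨N, fun n hn => ?_⟩
  have hn0 : (n : ℝ) ≠ 0 := by
    have : n ≠ 0 := by omega
    exact_mod_cast this
  have h1 := hN n hn
  rw [Real.dist_eq, add_zero, sub_zero] at h1
  rw [Real.dist_eq]
  have hcob : ∑ j ∈ Finset.range n, (ψ m (X (j + 1)) - T (X j)) + (T (X 0) - T (X n)) =
      ∑ j ∈ Finset.range n, (ψ m (X (j + 1)) - T (X (j + 1))) := by
    rw [← Finset.sum_range_sub' (fun j => T (X j)), ← Finset.sum_add_distrib]
    exact Finset.sum_congr rfl fun j _ => by ring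
  have hdecomp : (n : ℝ)⁻¹ * ∑ j ∈ Finset.range n, φ (X (j + 1)) - c =
      (n : ℝ)⁻¹ * ∑ j ∈ Finset.range n,
        (φ (X (j + 1)) - c - (ψ m (X (j + 1)) - T (X (j + 1)))) +
      (n : ℝ)⁻¹ * ∑ j ∈ Finset.range n, (ψ m (X (j + 1)) - T (X (j + 1))) := by
    rw [← mul_add, ← Finset.sum_add_distrib]
    simp only [sub_add_cancel, Finset.sum_sub_distrib, Finset.sum_const, Finset.card_range,
      nsmul_eq_mul]
    field_simp
  rw [← mul_add, hcob] at h1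
  have h2 : |(n : ℝ)⁻¹ * ∑ j ∈ Finset.range n,
      (φ (X (j + 1)) - c - (ψ m (X (j + 1)) - T (X (j + 1))))| ≤ 1 / ((m : ℝ) + 1) := by
    rw [abs_mul, abs_of_nonneg (by positivity), inv_mul_le_iff₀ (by positivity)]
    calc _ ≤ ∑ j ∈ Finset.range n, |φ (X (j + 1)) - c - (ψ m (X (j + 1)) - T (X (j + 1)))| :=
          Finset.abs_sum_le_sum_abs _ _
      _ ≤ ∑ _j ∈ Finset.range n, 1 / ((m : ℝ) + 1) := Finset.sum_le_sum fun j _ => hψ m _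
      _ = n * (1 / ((m : ℝ) + 1)) := by simp
  rw [hdecomp]
  calc _ ≤ _ + _ := abs_add_le _ _
    _ < ε / 2 + ε / 2 := add_lt_add (h2.trans_lt hm) h1
    _ = ε := add_halves ε
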